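/- For every nonnegative integer n, the number of partitions of 11n+6 is divisible by 11, i.e., p(11n+6) ≡ 0 (mod 11). -/

import Mathlib

open PowerSeries

section Jacobi

/-- The triangular number `j * (j + 1) / 2` for an integer `j`. -/
def triangular (j : ℤ) : ℕ := (j * (j + 1) / 2).toNat

theorem two_mul_natCast_triangular (j : ℤ) : 2 * (triangular j : ℤ) = j * (j + 1) := by
  have h : 2 ∣ j * (j + 1) := (Int.even_mul_succ_self j).two_dvd
  have h' : 0 ≤ j * (j + 1) := by
    rcases le_or_gt 0 j with hj | hj <;> nlinarith
  rw [triangular, Int.toNat_of_nonneg (by lia)]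
  lia

theorem natCast_triangular_add_one (j : ℤ) :
    (triangular (j + 1) : ℤ) = triangular j + (j + 1) := by
  linarith [two_mul_natCast_triangular j, two_mul_natCast_triangular (j + 1)]

variable (R : Type*) [CommRing R]

/-- The finite product `∏ k < m, (1 - X ^ (k + 1))`. -/
noncomputable def qFactorial (m : ℕ) : R⟦X⟧ := ∏ k ∈ Finset.range m, (1 - X ^ (k + 1))

theorem qFactorial_succ (m : ℕ) :
    qFactorial R (m + 1) = qFactorial R m * (1 - X ^ (m + 1)) :=
  Finset.prod_range_succ _ _

theorem isUnit_qFactorial (m : ℕ) : IsUnit (qFactorial R m) := by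
  simp [isUnit_iff_constantCoeff, qFactorial]

theorem isUnit_pentagonalSeries : IsUnit (pentagonalSeries R) := by
  rw [isUnit_iff_constantCoeff, ← coeff_zero_eq_constantCoeff_apply]
  have := coeff_pentagonalSeries_pentagonal R 0
  rw [show pentagonal 0 = 0 from rfl] at this
  simp [this]

theorem X_pow_dvd_qFactorial_sub {N m : ℕ} (h : N ≤ m) :
    X ^ N ∣ qFactorial R m - pentagonalSeries R := by
  rw [X_pow_dvd_iff]
  intro d hd
  obtain ⟨s, hs⟩ := Filter.eventually_atTop.1 (coeff_prod_one_sub_X_pow_eventually_eq R d)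
  obtain ⟨M, hM⟩ := s.exists_nat_subset_range
  have key : ∀ l, X ^ N ∣ qFactorial R (m + l) - qFactorial R m := by
    intro l
    induction l with
    | zero => simp
    | succ l ih =>
      have h1 : (X : R⟦X⟧) ^ N ∣ qFactorial R (m + l) * X ^ (m + l + 1) :=
        (pow_dvd_pow _ (by lia)).mul_left _
      have := dvd_sub ih h1
      rwa [show qFactorial R (m + l) - qFactorial R m - qFactorial R (m + l) * X ^ (m + l + 1) =
        qFactorial R (m + (l + 1)) - qFactorial R m by
          rw [← add_assoc, qFactorial_succ]; ring] at this
  have h2 := X_pow_dvd_iff.1 (key M) d hd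
  have h3 := hs (Finset.range (m + M))
    (hM.trans (Finset.range_mono (by lia)))
  rw [map_sub, sub_eq_zero] at h2
  rw [map_sub, ← h2, sub_eq_zero]
  exact h3

/-- The finite theta product `∏ k < n, (1 - z X ^ (k + 1)) (z - X ^ k)` as a polynomial in `z`. -/
noncomputable def thetaProd (n : ℕ) : Polynomial R⟦X⟧ :=
  ∏ k ∈ Finset.range n, (1 - .C (X ^ (k + 1)) * .X) * (.X - .C (X ^ k))

theorem thetaProd_succ (n : ℕ) : thetaProd R (n + 1) =
    thetaProd R n * ((1 - .C (X ^ (n + 1)) * .X) * (.X - .C (X ^ n))) :=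
  Finset.prod_range_succ _ _

theorem natDegree_thetaProd_le (n : ℕ) : (thetaProd R n).natDegree ≤ 2 * n := by
  induction n with
  | zero => simp [thetaProd]
  | succ n ih =>
    rw [thetaProd_succ]
    have : (((1 - .C (X ^ (n + 1)) * .X) * (.X - .C (X ^ n)) : Polynomial R⟦X⟧)).natDegree ≤ 2 := by
      compute_degree
    exact Polynomial.natDegree_mul_le.trans (by lia)

theorem coeff_zero_thetaProd (n : ℕ) :
    (thetaProd R n).coeff 0 = (-1) ^ n * X ^ triangular (-n) := by
  induction n with
  | zero => simp [thetaProd, triangular]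
  | succ n ih =>
    have h : triangular (-(n + 1 : ℕ)) = triangular (-n) + n := by
      have := natCast_triangular_add_one (-(n + 1 : ℕ))
      rw [show -((n + 1 : ℕ) : ℤ) + 1 = -n by push_cast; ring] at this
      lia
    rw [thetaProd_succ, Polynomial.mul_coeff_zero, ih, h]
    simp only [Polynomial.mul_coeff_zero, Polynomial.coeff_sub, Polynomial.coeff_one_zero,
      Polynomial.coeff_X_zero, Polynomial.coeff_C_zero]
    ring

theorem thetaProd_comp (n : ℕ) :
    (thetaProd R n).comp (.C X * .X) * (.C X * .X - .C (X ^ n)) =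
      -(.C (X ^ n) * (1 - .C (X ^ (n + 1)) * .X) * thetaProd R n) := by
  induction n with
  | zero => simp [thetaProd]
  | succ n ih =>
    rw [thetaProd_succ, Polynomial.mul_comp]
    simp only [Polynomial.mul_comp, Polynomial.sub_comp, Polynomial.X_comp, Polynomial.C_comp,
      Polynomial.one_comp]
    simp only [map_pow] at ih ⊢
    linear_combination (1 - .C X ^ (n + 1) * (.C X * .X)) * (.C X * .X - .C X ^ (n + 1)) * ih

theorem coeff_succ_thetaProd (n i : ℕ) (hi : i < 2 * n) :
    (thetaProd R n).coeff (i + 1) * X ^ n * (1 - X ^ (i + 1)) =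
      -((thetaProd R n).coeff i * X ^ (i + 1) * (1 - X ^ (2 * n - i))) := by
  have h := congrArg (Polynomial.coeff · (i + 1)) (thetaProd_comp R n)
  have e : (X : R⟦X⟧) ^ (i + 1) * X ^ (2 * n - i) = X ^ n * X ^ (n + 1) := by
    rw [← pow_add, ← pow_add]; congr 1; lia
  simp only [mul_sub, sub_mul, mul_one, ← mul_assoc, Polynomial.coeff_sub, Polynomial.coeff_neg,
    Polynomial.coeff_mul_C, Polynomial.coeff_mul_X, Polynomial.comp_C_mul_X_coeff] at h
  simp only [mul_assoc, Polynomial.coeff_C_mul, Polynomial.coeff_X_mul] at h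
  linear_combination h - (thetaProd R n).coeff i * e

theorem coeff_thetaProd [IsDomain R] (n i : ℕ) (hi : i ≤ 2 * n) :
    (thetaProd R n).coeff i * (qFactorial R i * qFactorial R (2 * n - i)) =
      (-1) ^ (n + i) * X ^ triangular (i - n) * qFactorial R (2 * n) := by
  induction i with
  | zero =>
    rw [coeff_zero_thetaProd]
    simp [qFactorial]
  | succ i ih =>
    specialize ih (by lia)
    have hX : (X : R⟦X⟧) ^ n ≠ 0 := pow_ne_zero _ X_ne_zero
    apply mul_left_cancel₀ hX
    have h := coeff_succ_thetaProd R n i hi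
    have ht : n + triangular ((i + 1 : ℕ) - n) = i + 1 + triangular (i - n) := by
      have := natCast_triangular_add_one (i - n)
      rw [show ((i : ℤ) - n + 1) = (i + 1 : ℕ) - n by push_cast; ring] at this
      lia
    have ht' : (X : R⟦X⟧) ^ n * X ^ triangular ((i + 1 : ℕ) - n) =
        X ^ (i + 1) * X ^ triangular (i - n) := by
      rw [← pow_add, ht, pow_add]
    obtain ⟨l, hl⟩ : ∃ l, 2 * n - i = l + 1 := ⟨2 * n - i - 1, by lia⟩
    rw [show 2 * n - (i + 1) = l by lia, qFactorial_succ R i]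
    rw [hl] at h ih
    rw [qFactorial_succ R l] at ih
    linear_combination qFactorial R i * qFactorial R l * h - X ^ (i + 1) * ih
      - (-1) ^ (n + (i + 1)) * qFactorial R (2 * n) * ht'

theorem eval_one_thetaProd (n : ℕ) : (thetaProd R (n + 1)).eval 1 = 0 := by
  rw [thetaProd, Polynomial.eval_prod, Finset.prod_range_succ']
  simp

theorem eval_one_derivative_thetaProd (n : ℕ) :
    (thetaProd R (n + 1)).derivative.eval 1 = qFactorial R (n + 1) * qFactorial R n := by
  rw [thetaProd, Finset.prod_mul_distrib,
    Finset.prod_range_succ' (fun k ↦ (Polynomial.X - Polynomial.C (X ^ k) : Polynomial R⟦X⟧))]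
  simp [Polynomial.derivative_mul, Polynomial.eval_prod, qFactorial]

theorem sum_coeff_thetaProd (n : ℕ) :
    ∑ i ∈ Finset.range (2 * (n + 1) + 1),
      (2 * ((i : R⟦X⟧) - ((n + 1 : ℕ) : R⟦X⟧)) + 1) * (thetaProd R (n + 1)).coeff i =
      2 * (qFactorial R (n + 1) * qFactorial R n) := by
  have hd := Nat.lt_succ_of_le (natDegree_thetaProd_le R (n + 1))
  have h0 := eval_one_thetaProd R n
  have h1 := eval_one_derivative_thetaProd R n
  rw [Polynomial.eval_eq_sum_range' hd] at h0
  rw [Polynomial.derivative_eval, Polynomial.sum_over_range' _ (by simp) _ hd] at h1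
  simp only [one_pow, mul_one] at h0 h1
  rw [← h1]
  calc _ = 2 * ∑ i ∈ Finset.range (2 * (n + 1) + 1), (thetaProd R (n + 1)).coeff i * i +
      (1 - 2 * (n + 1 : ℕ)) *
        ∑ i ∈ Finset.range (2 * (n + 1) + 1), (thetaProd R (n + 1)).coeff i := by
        rw [Finset.mul_sum, Finset.mul_sum, ← Finset.sum_add_distrib]
        exact Finset.sum_congr rfl fun i _ ↦ by ring
    _ = _ := by rw [h0]; simp

theorem le_triangular {N : ℕ} {j : ℤ} (h : N ≤ j ∨ j ≤ -(N + 1)) : N ≤ triangular j := by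
  have := two_mul_natCast_triangular j
  have : (2 * N : ℤ) ≤ j * (j + 1) := by
    rcases h with h | h
    · rcases N.eq_zero_or_pos with rfl | hN
      · rcases h.eq_or_lt with h | h <;> nlinarith
      · nlinarith
    · rcases N.eq_zero_or_pos with rfl | hN
      · nlinarith
      · nlinarith
  lia

theorem X_pow_dvd_coeff_thetaProd_mul_sub [IsDomain R] (N i : ℕ) (hi : i ≤ 2 * (2 * N)) :
    X ^ N ∣ (thetaProd R (2 * N)).coeff i * pentagonalSeries R -
      (-1) ^ (2 * N + i) * X ^ triangular (i - (2 * N : ℕ)) := by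
  have h := coeff_thetaProd R (2 * N) i hi
  by_cases hN : N ≤ i ∧ i ≤ 3 * N
  · have h1 := X_pow_dvd_qFactorial_sub R hN.1
    have h2 := X_pow_dvd_qFactorial_sub R (show N ≤ 2 * (2 * N) - i by lia)
    have h3 := X_pow_dvd_qFactorial_sub R (show N ≤ 2 * (2 * N) by lia)
    rw [← (isUnit_pentagonalSeries R).dvd_mul_left]
    generalize pentagonalSeries R = E at *
    generalize qFactorial R i = A at *
    generalize qFactorial R (2 * (2 * N) - i) = B at *
    generalize qFactorial R (2 * (2 * N)) = D at *
    generalize (thetaProd R (2 * N)).coeff i = c at *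
    generalize (X : R⟦X⟧) ^ triangular (i - (2 * N : ℕ)) = t at *
    have := dvd_sub (h3.mul_left ((-1) ^ (2 * N + i) * t))
      (dvd_add (h1.mul_left (c * B)) (h2.mul_left (c * E)))
    convert this using 1
    linear_combination h
  · have ht : (X : R⟦X⟧) ^ N ∣ X ^ triangular (i - (2 * N : ℕ)) :=
      pow_dvd_pow _ (le_triangular (by lia))
    refine dvd_sub (Dvd.dvd.mul_right ?_ _) (ht.mul_left _)
    rw [← ((isUnit_qFactorial R i).mul (isUnit_qFactorial R (2 * (2 * N) - i))).dvd_mul_right, h]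
    exact (ht.mul_left _).mul_right _

/-- **Jacobi's identity** for the cube of Euler's product, at the level of a single coefficient. -/
theorem coeff_two_mul_pentagonalSeries_pow_three [IsDomain R] (m : ℕ) :
    coeff m (2 * pentagonalSeries R ^ 3) =
      ∑ i ∈ Finset.range (2 * (2 * (m + 1)) + 1),
        if m = triangular (i - (2 * (m + 1) : ℕ)) then
          (2 * ((i : R) - ((2 * (m + 1) : ℕ) : R)) + 1) * (-1) ^ (2 * (m + 1) + i) else 0 := by
  have hs := sum_coeff_thetaProd R (2 * m + 1)
  rw [show 2 * m + 1 + 1 = 2 * (m + 1) by ring] at hs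
  have h1 := X_pow_dvd_qFactorial_sub R (show m + 1 ≤ 2 * (m + 1) by lia)
  have h2 := X_pow_dvd_qFactorial_sub R (show m + 1 ≤ 2 * m + 1 by lia)
  have h3 : X ^ (m + 1) ∣ ∑ i ∈ Finset.range (2 * (2 * (m + 1)) + 1),
      (2 * ((i : R⟦X⟧) - ((2 * (m + 1) : ℕ) : R⟦X⟧)) + 1) *
        ((thetaProd R (2 * (m + 1))).coeff i * pentagonalSeries R -
      (-1) ^ (2 * (m + 1) + i) * X ^ triangular (i - (2 * (m + 1) : ℕ))) :=
    Finset.dvd_sum fun i hi ↦ (X_pow_dvd_coeff_thetaProd_mul_sub R (m + 1) i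
      (by have := Finset.mem_range.1 hi; lia)).mul_left _
  simp only [mul_sub (2 * (_ : R⟦X⟧) + 1), Finset.sum_sub_distrib] at h3
  simp only [← mul_assoc (2 * (_ : R⟦X⟧) + 1)] at h3
  rw [← Finset.sum_mul, hs] at h3
  have h4 := dvd_sub h3 (dvd_add (h1.mul_left (2 * qFactorial R (2 * m + 1) * pentagonalSeries R))
    (h2.mul_left (2 * pentagonalSeries R ^ 2)))
  have h5 : X ^ (m + 1) ∣ 2 * pentagonalSeries R ^ 3 -
      ∑ i ∈ Finset.range (2 * (2 * (m + 1)) + 1),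
        (2 * ((i : R⟦X⟧) - ((2 * (m + 1) : ℕ) : R⟦X⟧)) + 1) * (-1) ^ (2 * (m + 1) + i) *
          X ^ triangular (i - (2 * (m + 1) : ℕ)) := by
    convert h4 using 1
    ring
  have h6 := X_pow_dvd_iff.1 h5 m (by lia)
  rw [map_sub, sub_eq_zero, map_sum] at h6
  rw [h6]
  refine Finset.sum_congr rfl fun i _ ↦ ?_
  have hC : (2 * ((i : R⟦X⟧) - ((2 * (m + 1) : ℕ) : R⟦X⟧)) + 1) * (-1) ^ (2 * (m + 1) + i) =
      C ((2 * ((i : R) - ((2 * (m + 1) : ℕ) : R)) + 1) * (-1) ^ (2 * (m + 1) + i)) := by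
    have h2 : (C 2 : R⟦X⟧) = 2 := map_ofNat C 2
    simp [h2]
  rw [hC, coeff_C_mul, coeff_X_pow, mul_ite, mul_one, mul_zero]

end Jacobi

section ResiduePart

variable {R : Type*} [CommRing R]

/-- The part of a power series supported on exponents congruent to `r` modulo `d`. -/
noncomputable def residuePart (d r : ℕ) (f : R⟦X⟧) : R⟦X⟧ :=
  .mk fun n ↦ if n % d = r then coeff n f else 0

theorem coeff_residuePart (d r n : ℕ) (f : R⟦X⟧) :
    coeff n (residuePart d r f) = if n % d = r then coeff n f else 0 :=
  coeff_mk _ _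

theorem residuePart_eq_zero {d r : ℕ} {f : R⟦X⟧} (h : ∀ n, n % d = r → coeff n f = 0) :
    residuePart d r f = 0 := by
  ext n
  rw [coeff_residuePart, map_zero, ite_eq_right_iff]
  exact h n

theorem Nat.mod_eq_add_sub_mod_iff {d r : ℕ} (hr : r < d) (x y : ℕ) :
    y % d = (r + (d - x % d)) % d ↔ (x + y) % d = r := by
  have hx : x % d < d := Nat.mod_lt _ (by lia)
  constructor <;> intro h
  · have h1 := Nat.ModEq.add_left (x % d) (show y ≡ r + (d - x % d) [MOD d] from h)
    rw [show x % d + (r + (d - x % d)) = r + d by lia] at h1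
    have h2 : (x + y) % d = (r + d) % d := ((Nat.mod_modEq x d).symm.add_right y).trans h1
    rwa [Nat.add_mod_right, Nat.mod_eq_of_lt hr] at h2
  · refine Nat.ModEq.add_left_cancel' (x % d) (?_ : x % d + y ≡ _ [MOD d])
    rw [show x % d + (r + (d - x % d)) = r + d by lia]
    refine ((Nat.mod_modEq x d).add_right y).trans ?_
    rw [Nat.ModEq, h, Nat.add_mod_right, Nat.mod_eq_of_lt hr]

theorem residuePart_mul {d r : ℕ} (hr : r < d) (f g : R⟦X⟧) :
    residuePart d r (f * g) =
      ∑ s ∈ Finset.range d, residuePart d s f * residuePart d ((r + (d - s)) % d) g := by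
  have hd : 0 < d := by lia
  ext n
  simp only [map_sum, coeff_mul, coeff_residuePart]
  rw [Finset.sum_comm, Finset.ite_sum_zero]
  refine Finset.sum_congr rfl fun x hx ↦ ?_
  rw [Finset.sum_eq_single_of_mem (x.1 % d) (Finset.mem_range.2 (Nat.mod_lt _ hd))
    (fun s _ hs ↦ by rw [if_neg hs.symm, zero_mul])]
  simp only [if_true, Nat.mod_eq_add_sub_mod_iff hr,
    Finset.HasAntidiagonal.mem_antidiagonal.1 hx, mul_ite,
    mul_zero]

theorem residuePart_mul_of_support {d : ℕ} (r : ℕ) (f g : R⟦X⟧)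
    (hg : ∀ n, ¬ d ∣ n → coeff n g = 0) :
    residuePart d r (f * g) = residuePart d r f * g := by
  ext n
  simp only [coeff_mul, coeff_residuePart]
  rw [Finset.ite_sum_zero]
  refine Finset.sum_congr rfl fun x hx ↦ ?_
  by_cases hd : d ∣ x.2
  · obtain ⟨k, hk⟩ := hd
    rw [← Finset.HasAntidiagonal.mem_antidiagonal.1 hx, hk, Nat.add_mul_mod_self_left, ite_mul,
      zero_mul]
  · simp [hg x.2 hd]

end ResiduePart

section ModEleven

open scoped PowerSeries.WithPiTopology

instance fact_prime_eleven : Fact (Nat.Prime 11) := ⟨by norm_num⟩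

theorem coeff_pow_eq_zero_of_not_dvd {p : ℕ} [Fact p.Prime] (f : (ZMod p)⟦X⟧) {n : ℕ}
    (hn : ¬ p ∣ n) : coeff n (f ^ p) = 0 := by
  have h : (f.expand p (NeZero.ne p)).map (frobenius (ZMod p) p) = f ^ p :=
    MvPowerSeries.map_frobenius_expand p (NeZero.ne p)
  rw [← h, coeff_map, coeff_expand_of_not_dvd p _ f hn, map_zero]

theorem residuePart_pentagonalSeries {r : ℕ}
    (hr : r = 3 ∨ r = 6 ∨ r = 8 ∨ r = 9 ∨ r = 10) :
    residuePart 11 r (pentagonalSeries (ZMod 11)) = 0 := by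
  refine residuePart_eq_zero fun n hn ↦ coeff_pentagonalSeries_eq_zero _ ?_
  rintro ⟨k, rfl⟩
  have h := congrArg (Int.cast : ℤ → ZMod 11) (two_mul_natCast_pentagonal k)
  have hn' : ((pentagonal k : ℕ) : ZMod 11) = (r : ZMod 11) := by
    rw [← hn, ZMod.natCast_mod]
  push_cast at h
  rw [hn'] at h
  generalize (k : ZMod 11) = x at h
  rcases hr with rfl | rfl | rfl | rfl | rfl <;> revert x <;> decide

theorem residuePart_pentagonalSeries_pow_three {r : ℕ}
    (hr : r = 2 ∨ r = 4 ∨ r = 5 ∨ r = 7 ∨ r = 8 ∨ r = 9) :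
    residuePart 11 r (pentagonalSeries (ZMod 11) ^ 3) = 0 := by
  refine residuePart_eq_zero fun n hn ↦ ?_
  have h2 : (C 2 : (ZMod 11)⟦X⟧) = 2 := map_ofNat C 2
  have h := coeff_two_mul_pentagonalSeries_pow_three (ZMod 11) n
  rw [← h2, coeff_C_mul, Finset.sum_eq_zero fun i _ ↦ ?_] at h
  · exact (mul_eq_zero.1 h).resolve_left (by decide)
  split_ifs with ht
  · have hj := congrArg (Int.cast : ℤ → ZMod 11)
      (two_mul_natCast_triangular (i - (2 * (n + 1) : ℕ)))
    have hn' : (n : ZMod 11) = (r : ZMod 11) := by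
      rw [← hn, ZMod.natCast_mod]
    rw [← ht, Int.cast_mul, Int.cast_natCast, hn', Int.cast_mul, Int.cast_add, Int.cast_sub,
      Int.cast_natCast, Int.cast_natCast] at hj
    generalize (i : ZMod 11) - ((2 * (n + 1) : ℕ) : ZMod 11) = x at hj
    have hx : 2 * x + 1 = 0 := by
      rcases hr with rfl | rfl | rfl | rfl | rfl | rfl <;> revert x <;> decide
    rw [hx, zero_mul]
  · rfl

theorem degree_seven_eq_zero_of_degree_four {S : Type*} [CommRing S] (h : (11 : S) = 0)
    {a b c d e : S}
    (h3 : 4 * a ^ 3 * c + 4 * a * b ^ 3 + 24 * a * b * c * e + 6 * b ^ 2 * d ^ 2 +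
    12 * c * d ^ 2 * e + 4 * d * e ^ 3 = 0)
    (h6 : 4 * a ^ 3 * d + 6 * a ^ 2 * c ^ 2 + 24 * a * b * d * e + 4 * b ^ 3 * c +
    12 * b * c ^ 2 * e + 4 * d ^ 3 * e = 0)
    (h8 : 12 * a * b ^ 2 * d + 24 * a * c * d * e + 4 * a * e ^ 3 + 6 * b ^ 2 * c ^ 2 +
    4 * b * d ^ 3 + 4 * c ^ 3 * e = 0)
    (h9 : 12 * a ^ 2 * c * d + 6 * a ^ 2 * e ^ 2 + 4 * a * c ^ 3 + 4 * b ^ 3 * d +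
    24 * b * c * d * e + 4 * b * e ^ 3 = 0)
    (h10 : 4 * a ^ 3 * e + 24 * a * b * c * d + 12 * a * b * e ^ 2 + 4 * b * c ^ 3 + 4 * c * d ^ 3
    + 6 * d ^ 2 * e ^ 2 = 0) :
    7 * a ^ 6 * d + 21 * a ^ 5 * c ^ 2 + 210 * a ^ 4 * b * d * e + 140 * a ^ 3 * b ^ 3 * c +
    420 * a ^ 3 * b * c ^ 2 * e + 140 * a ^ 3 * d ^ 3 * e + 630 * a ^ 2 * b ^ 2 * c * d ^ 2 +
    630 * a ^ 2 * b ^ 2 * d * e ^ 2 + 630 * a ^ 2 * c ^ 2 * d ^ 2 * e +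
    420 * a ^ 2 * c * d * e ^ 3 + 21 * a ^ 2 * e ^ 5 + 7 * a * b ^ 6 + 210 * a * b ^ 4 * c * e +
    420 * a * b ^ 2 * c ^ 3 * d + 630 * a * b ^ 2 * c ^ 2 * e ^ 2 + 210 * a * b * c * d ^ 4 +
    420 * a * b * d ^ 3 * e ^ 2 + 210 * a * c ^ 4 * d * e + 140 * a * c ^ 3 * e ^ 3 +
    21 * b ^ 5 * d ^ 2 + 420 * b ^ 3 * c * d ^ 2 * e + 140 * b ^ 3 * d * e ^ 3 +
    21 * b ^ 2 * c ^ 5 + 140 * b * c ^ 3 * d ^ 3 + 630 * b * c ^ 2 * d ^ 2 * e ^ 2 +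
    210 * b * c * d * e ^ 4 + 7 * b * e ^ 6 + 7 * c ^ 6 * e + 7 * c * d ^ 6 + 21 * d ^ 5 * e ^ 2 =
    0 := by
  linear_combination (4 * a ^ 2 * c - b ^ 3 - b * c * e) * h3 + (4 * d ^ 2 * e - a ^ 3 -
  a * b * e) * h6 + (4 * a * e ^ 2 - a * c * d - c ^ 3) * h8 + (4 * b ^ 2 * d - c * d * e -
  e ^ 3) * h9 + (4 * b * c ^ 2 - a * b * d - d ^ 3) * h10 + (a ^ 6 * d + a ^ 5 * c ^ 2 +
  22 * a ^ 4 * b * d * e + 12 * a ^ 3 * b ^ 3 * c + 30 * a ^ 3 * b * c ^ 2 * e +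
  12 * a ^ 3 * d ^ 3 * e + 54 * a ^ 2 * b ^ 2 * c * d ^ 2 + 54 * a ^ 2 * b ^ 2 * d * e ^ 2 +
  54 * a ^ 2 * c ^ 2 * d ^ 2 * e + 30 * a ^ 2 * c * d * e ^ 3 + a ^ 2 * e ^ 5 + a * b ^ 6 +
  22 * a * b ^ 4 * c * e + 30 * a * b ^ 2 * c ^ 3 * d + 54 * a * b ^ 2 * c ^ 2 * e ^ 2 +
  22 * a * b * c * d ^ 4 + 30 * a * b * d ^ 3 * e ^ 2 + 22 * a * c ^ 4 * d * e +
  12 * a * c ^ 3 * e ^ 3 + b ^ 5 * d ^ 2 + 30 * b ^ 3 * c * d ^ 2 * e + 12 * b ^ 3 * d * e ^ 3 +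
  b ^ 2 * c ^ 5 + 12 * b * c ^ 3 * d ^ 3 + 54 * b * c ^ 2 * d ^ 2 * e ^ 2 + 22 * b * c * d * e ^ 4
  + b * e ^ 6 + c ^ 6 * e + c * d ^ 6 + d ^ 5 * e ^ 2) * h

theorem residuePart_six_pow_seven {J : (ZMod 11)⟦X⟧}
    (hJ : ∀ r, r = 2 ∨ r = 4 ∨ r = 5 ∨ r = 7 ∨ r = 8 ∨ r = 9 → residuePart 11 r J = 0)
    (hJ4 : ∀ r, r = 3 ∨ r = 6 ∨ r = 8 ∨ r = 9 ∨ r = 10 → residuePart 11 r (J ^ 4) = 0) :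
    residuePart 11 6 (J ^ 7) = 0 := by
  have z2 := hJ 2 (by simp)
  have z4 := hJ 4 (by simp)
  have z5 := hJ 5 (by simp)
  have z7 := hJ 7 (by simp)
  have z8 := hJ 8 (by simp)
  have z9 := hJ 9 (by simp)
  have h11 : (11 : (ZMod 11)⟦X⟧) = 0 := by
    rw [← map_ofNat C 11, show (OfNat.ofNat 11 : ZMod 11) = 0 from by decide, map_zero]
  have hK4 : J ^ 4 = (J * J) * (J * J) := by ring
  have hK7 : J ^ 7 = (J * J) * (J * J) * (J * (J * J)) := by ring
  rw [hK4] at hJ4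
  rw [hK7]
  have q0 : residuePart 11 0 (J * J) = residuePart 11 0 J ^ 2 +
      2 * residuePart 11 1 J * residuePart 11 10 J := by
    simp [residuePart_mul, Finset.sum_range_succ, *]; ring
  have q1 : residuePart 11 1 (J * J) = 2 * residuePart 11 0 J * residuePart 11 1 J +
      residuePart 11 6 J ^ 2 := by
    simp [residuePart_mul, Finset.sum_range_succ, *]; ring
  have q2 : residuePart 11 2 (J * J) = residuePart 11 1 J ^ 2 +
      2 * residuePart 11 3 J * residuePart 11 10 J := by
    simp [residuePart_mul, Finset.sum_range_succ, *]; ring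
  have q3 : residuePart 11 3 (J * J) = 2 * residuePart 11 0 J * residuePart 11 3 J := by
    simp [residuePart_mul, Finset.sum_range_succ, *]; ring
  have q4 : residuePart 11 4 (J * J) = 2 * residuePart 11 1 J * residuePart 11 3 J := by
    simp [residuePart_mul, Finset.sum_range_succ, *]; ring
  have q5 : residuePart 11 5 (J * J) = 2 * residuePart 11 6 J * residuePart 11 10 J := by
    simp [residuePart_mul, Finset.sum_range_succ, *]; ring
  have q6 : residuePart 11 6 (J * J) = 2 * residuePart 11 0 J * residuePart 11 6 J +
      residuePart 11 3 J ^ 2 := by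
    simp [residuePart_mul, Finset.sum_range_succ, *]; ring
  have q7 : residuePart 11 7 (J * J) = 2 * residuePart 11 1 J * residuePart 11 6 J := by
    simp [residuePart_mul, Finset.sum_range_succ, *]; ring
  have q8 : residuePart 11 8 (J * J) = 0 := by
    simp [residuePart_mul, Finset.sum_range_succ, *]
  have q9 : residuePart 11 9 (J * J) = 2 * residuePart 11 3 J * residuePart 11 6 J +
      residuePart 11 10 J ^ 2 := by
    simp [residuePart_mul, Finset.sum_range_succ, *]; ring
  have q10 : residuePart 11 10 (J * J) = 2 * residuePart 11 0 J * residuePart 11 10 J := by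
    simp [residuePart_mul, Finset.sum_range_succ, *]; ring
  generalize J * J = K at *
  have s3 := hJ4 3 (by simp)
  have s6 := hJ4 6 (by simp)
  have s8 := hJ4 8 (by simp)
  have s9 := hJ4 9 (by simp)
  have s10 := hJ4 10 (by simp)
  rw [residuePart_mul (by norm_num)] at s3 s6 s8 s9 s10 ⊢
  simp only [Finset.sum_range_succ, Finset.sum_range_zero, Nat.reduceSub, Nat.reduceAdd,
    Nat.reduceMod, q0, q1, q2, q3, q4, q5, q6, q7, q8, q9, q10] at s3 s6 s8 s9 s10
  simp only [residuePart_mul (show 0 < 11 by norm_num), residuePart_mul (show 1 < 11 by norm_num),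
    residuePart_mul (show 2 < 11 by norm_num), residuePart_mul (show 3 < 11 by norm_num),
    residuePart_mul (show 4 < 11 by norm_num), residuePart_mul (show 5 < 11 by norm_num),
    residuePart_mul (show 6 < 11 by norm_num), residuePart_mul (show 7 < 11 by norm_num),
    residuePart_mul (show 8 < 11 by norm_num), residuePart_mul (show 9 < 11 by norm_num),
    residuePart_mul (show 10 < 11 by norm_num),
    Finset.sum_range_succ, Finset.sum_range_zero, Nat.reduceSub, Nat.reduceAdd, Nat.reduceMod,
    q0, q1, q2, q3, q4, q5, q6, q7, q8, q9, q10, z2, z4, z5, z7, z8, z9, zero_mul, mul_zero,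
    add_zero, zero_add]
  generalize residuePart 11 0 J = a at *
  generalize residuePart 11 1 J = b at *
  generalize residuePart 11 3 J = c at *
  generalize residuePart 11 6 J = d at *
  generalize residuePart 11 10 J = e at *
  refine Eq.trans ?_ (degree_seven_eq_zero_of_degree_four h11 (a := a) (b := b) (c := c) (d := d)
    (e := e) ?_ ?_ ?_ ?_ ?_)
  · ring
  · linear_combination s3
  · linear_combination s6
  · linear_combination s8
  · linear_combination s9
  · linear_combination s10

theorem mk_card_partition_mul_pentagonalSeries :
    (.mk fun n ↦ (Fintype.card n.Partition : ZMod 11)) * pentagonalSeries (ZMod 11) = 1 := by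
  have h := (Nat.Partition.hasProd_powerSeriesMk_card_restricted (ZMod 11) (fun _ ↦ True)).mul
    (WithPiTopology.hasProd_one_sub_X_pow (ZMod 11))
  simp only [if_true, pow_mul] at h
  have hgeom (i : ℕ) :
      (∑' j : ℕ, ((X : (ZMod 11)⟦X⟧) ^ (i + 1)) ^ j) * (1 - X ^ (i + 1)) = 1 :=
    WithPiTopology.tsum_pow_mul_one_sub_of_constantCoeff_eq_zero (by simp)
  simp only [hgeom] at h
  have := h.unique hasProd_one
  simpa [Nat.Partition.restricted] using this

end ModEleven

/-- **Ramanujan's congruence modulo 11**: for every nonnegative integer `n`,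
the number of partitions of `11 * n + 6` is divisible by `11`. -/
theorem ramanujan_congruence_mod_eleven (n : ℕ) :
    11 ∣ Fintype.card (Nat.Partition (11 * n + 6)) := by
  have hP := mk_card_partition_mul_pentagonalSeries
  set E := pentagonalSeries (ZMod 11)
  set P : (ZMod 11)⟦X⟧ := .mk fun n ↦ (Fintype.card n.Partition : ZMod 11) with hPdef
  have hsupp (m : ℕ) (hm : ¬ 11 ∣ m) : coeff m (E ^ 11) = 0 := coeff_pow_eq_zero_of_not_dvd E hm
  have h7 : residuePart 11 6 ((E ^ 3) ^ 7) = 0 := by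
    refine residuePart_six_pow_seven (fun r ↦ residuePart_pentagonalSeries_pow_three)
      fun r hr ↦ ?_
    rw [show (E ^ 3) ^ 4 = E * E ^ 11 by ring, residuePart_mul_of_support _ _ _ hsupp,
      residuePart_pentagonalSeries hr, zero_mul]
  rw [show (E ^ 3) ^ 7 = P * E ^ 11 * E ^ 11 by linear_combination (-E ^ 21) * hP,
    residuePart_mul_of_support _ _ _ hsupp, residuePart_mul_of_support _ _ _ hsupp] at h7
  have hE : E ^ 11 ≠ 0 := pow_ne_zero _ (isUnit_pentagonalSeries (ZMod 11)).ne_zero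
  have h6 := congrArg (coeff (11 * n + 6))
    ((mul_eq_zero.1 ((mul_eq_zero.1 h7).resolve_right hE)).resolve_right hE)
  rw [coeff_residuePart, if_pos (by lia), hPdef, coeff_mk, map_zero] at h6
  exact (ZMod.natCast_eq_zero_iff _ _).1 h6
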